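/- Let n ≥ 2 and let f, g : ℝ₊ → ℝⁿ be any two coarse maps (with respect to the Euclidean metrics). Then f and g are coarsely homotopic. -/

import Mathlib

open scoped NNReal

/-- A map between metric spaces is controlled if points at distance `≤ R`
are mapped to points at distance `≤ S = S(R)`. -/
def Controlled {X Y : Type*} [PseudoMetricSpace X] [PseudoMetricSpace Y] (f : X → Y) : Prop :=
  ∀ R : ℝ, 0 < R → ∃ S : ℝ, 0 < S ∧ ∀ x y : X, dist x y ≤ R → dist (f x) (f y) ≤ S

/-- A map between metric spaces is coarse if it is controlled and preimages
of bounded sets are bounded. -/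
def IsCoarseMap {X Y : Type*} [PseudoMetricSpace X] [PseudoMetricSpace Y] (f : X → Y) : Prop :=
  Controlled f ∧ ∀ B : Set Y, Bornology.IsBounded B → Bornology.IsBounded (f ⁻¹' B)

/-- The `p`-cylinder `I_pX = {(x,t) ∈ X × ℝ₊ : t ≤ p x + 1}`; as a subset of the
product `X × ℝ₊` it carries the sup metric `max (dist x y) |s - t|`. -/
def cylSet {X : Type*} (p : X → ℝ≥0) : Set (X × ℝ≥0) :=
  {z | z.2 ≤ p z.1 + 1}

/-- Two coarse maps `f₀ f₁ : X → Y` are coarsely homotopic if there is a coarse map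
`p : X → ℝ₊` and a coarse map `H : I_pX → Y` with `H ∘ i₀ = f₀` and `H ∘ i₁ = f₁`,
where `i₀ x = (x, 0)` and `i₁ x = (x, p x + 1)`. -/
def CoarseHomotopic {X Y : Type*} [PseudoMetricSpace X] [PseudoMetricSpace Y]
    (f₀ f₁ : X → Y) : Prop :=
  ∃ p : X → ℝ≥0, IsCoarseMap p ∧ ∃ H : cylSet p → Y, IsCoarseMap H ∧
    (∀ x : X, H ⟨(x, 0), by simp [cylSet]⟩ = f₀ x) ∧
    (∀ x : X, H ⟨(x, p x + 1), by simp [cylSet]⟩ = f₁ x)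

theorem Controlled.isBounded_image {X Y : Type*} [PseudoMetricSpace X] [PseudoMetricSpace Y]
    {f : X → Y} (hf : Controlled f) {A : Set X} (hA : Bornology.IsBounded A) :
    Bornology.IsBounded (f '' A) := by
  obtain ⟨R, hR⟩ := Metric.isBounded_iff.1 hA
  obtain ⟨S, -, hS⟩ := hf (max R 1) (by positivity)
  refine Metric.isBounded_iff.2 ⟨S, ?_⟩
  rintro _ ⟨x, hx, rfl⟩ _ ⟨y, hy, rfl⟩
  exact hS x y ((hR hx hy).trans (le_max_left _ _))

theorem dist_cylSet_le_iff {X : Type*} [PseudoMetricSpace X] {p : X → ℝ≥0} (z w : cylSet p)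
    (R : ℝ) : dist z w ≤ R ↔ dist z.1.1 w.1.1 ≤ R ∧ |(z.1.2 : ℝ) - w.1.2| ≤ R := by
  rw [Subtype.dist_eq, Prod.dist_eq, max_le_iff, NNReal.dist_eq]

theorem CoarseHomotopic.symm {X Y : Type*} [PseudoMetricSpace X] [PseudoMetricSpace Y]
    {f g : X → Y} (h : CoarseHomotopic f g) : CoarseHomotopic g f := by
  obtain ⟨p, hp, H, hH, h0, h1⟩ := h
  let r : cylSet p → cylSet p := fun z => ⟨(z.1.1, p z.1.1 + 1 - z.1.2),
    show p z.1.1 + 1 - z.1.2 ≤ p z.1.1 + 1 from tsub_le_self⟩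
  have hz (z : cylSet p) : ((p z.1.1 + 1 - z.1.2 : ℝ≥0) : ℝ) = p z.1.1 + 1 - z.1.2 := by
    rw [NNReal.coe_sub z.2]; simp
  have hr : Controlled r := by
    intro R hR
    obtain ⟨S, hS, hpS⟩ := hp.1 R hR
    refine ⟨S + R, by positivity, fun z w hzw => ?_⟩
    rw [dist_cylSet_le_iff] at hzw ⊢
    have := hpS _ _ hzw.1
    rw [NNReal.dist_eq] at this
    refine ⟨hzw.1.trans (by linarith), ?_⟩
    simp only [r, hz]
    grind
  have hrr : ∀ z, r (r z) = z := by
    intro z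
    apply Subtype.ext
    apply Prod.ext
    · rfl
    · exact tsub_tsub_cancel_of_le z.2
  refine ⟨p, hp, H ∘ r, ⟨?_, ?_⟩, ?_, ?_⟩
  · intro R hR
    obtain ⟨S, hS, hrS⟩ := hr R hR
    obtain ⟨T, hT, hHT⟩ := hH.1 S hS
    exact ⟨T, hT, fun z w hzw => hHT _ _ (hrS _ _ hzw)⟩
  · intro B hB
    refine (hr.isBounded_image (hH.2 B hB)).subset fun z hz => ⟨r z, hz, hrr z⟩
  · intro x
    simpa [r] using h1 x
  · intro x
    simpa [r] using h0 x

theorem CoarseHomotopic.trans {X Y : Type*} [PseudoMetricSpace X] [PseudoMetricSpace Y]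
    {f g h : X → Y} (hfg : CoarseHomotopic f g) (hgh : CoarseHomotopic g h) :
    CoarseHomotopic f h := by
  obtain ⟨p, hp, H, hH, hH0, hH1⟩ := hfg
  obtain ⟨q, hq, K, hK, hK0, hK1⟩ := hgh
  have hPc : Controlled fun x => p x + q x + 1 := by
    intro R hR
    obtain ⟨S, hS, hpS⟩ := hp.1 R hR
    obtain ⟨T, hT, hqT⟩ := hq.1 R hR
    refine ⟨S + T, by positivity, fun x y hxy => ?_⟩
    have h1 := hpS x y hxy
    have h2 := hqT x y hxy
    rw [NNReal.dist_eq] at *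
    push_cast
    grind
  have hPb : ∀ B : Set ℝ≥0, Bornology.IsBounded B →
      Bornology.IsBounded ((fun x => p x + q x + 1) ⁻¹' B) := by
    intro B hB
    obtain ⟨r, hr⟩ := hB.subset_closedBall 0
    refine (hp.2 _ Metric.isBounded_closedBall).subset (t := p ⁻¹' Metric.closedBall 0 r) ?_
    intro x hx
    have := hr hx
    simp only [Metric.mem_closedBall, NNReal.dist_eq, Set.mem_preimage] at this ⊢
    push_cast at this
    have h1 := (p x).2
    have h2 := (q x).2
    rw [sub_zero, abs_of_nonneg (by positivity)] at *
    linarith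
  have hsub (z : cylSet fun x => p x + q x + 1) : z.1.2 - (p z.1.1 + 1) ≤ q z.1.1 + 1 := by
    have := z.2
    simp only [cylSet, Set.mem_ofPred_eq] at this
    rw [tsub_le_iff_left]
    calc _ ≤ _ := this
      _ = _ := by ring
  let L : (cylSet fun x => p x + q x + 1) → Y := fun z =>
    if hz : z.1.2 ≤ p z.1.1 + 1 then H ⟨(z.1.1, z.1.2), hz⟩
    else K ⟨(z.1.1, z.1.2 - (p z.1.1 + 1)), hsub z⟩
  have hLH (z) (hz : z.1.2 ≤ p z.1.1 + 1) : L z = H ⟨(z.1.1, z.1.2), hz⟩ := dif_pos hz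
  have hLK (z) (hz : ¬ z.1.2 ≤ p z.1.1 + 1) :
      L z = K ⟨(z.1.1, z.1.2 - (p z.1.1 + 1)), hsub z⟩ := dif_neg hz
  have hcoe (z : cylSet fun x => p x + q x + 1) (hz : ¬ z.1.2 ≤ p z.1.1 + 1) :
      ((z.1.2 - (p z.1.1 + 1) : ℝ≥0) : ℝ) = z.1.2 - (p z.1.1 + 1) := by
    rw [NNReal.coe_sub (not_le.1 hz).le]; simp
  refine ⟨fun x => p x + q x + 1, ⟨hPc, hPb⟩, L, ⟨?_, ?_⟩, ?_, ?_⟩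
  · intro R hR
    obtain ⟨P, hP, hpP⟩ := hp.1 R hR
    obtain ⟨S, hS, hHS⟩ := hH.1 (R + P) (by positivity)
    obtain ⟨T, hT, hKT⟩ := hK.1 (R + P) (by positivity)
    have mixed (z w) (hzw : dist z w ≤ R) (hz : z.1.2 ≤ p z.1.1 + 1)
        (hw : ¬ w.1.2 ≤ p w.1.1 + 1) : dist (L z) (L w) ≤ S + T := by
      rw [hLH z hz, hLK w hw]
      rw [dist_cylSet_le_iff] at hzw
      have h1 := hpP _ _ hzw.1
      have hz' : (z.1.2 : ℝ) ≤ p z.1.1 + 1 := mod_cast hz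
      have hw' : (p w.1.1 + 1 : ℝ) < w.1.2 := mod_cast not_le.1 hw
      rw [NNReal.dist_eq] at h1
      have hx := (hH1 z.1.1).trans (hK0 z.1.1).symm
      refine (dist_triangle _ (H ⟨(z.1.1, p z.1.1 + 1), by simp [cylSet]⟩) _).trans
        (add_le_add (hHS _ _ ?_) ?_)
      · rw [dist_cylSet_le_iff]
        refine ⟨by simp; positivity, ?_⟩
        push_cast
        grind
      · rw [hx]
        refine hKT _ _ ?_
        rw [dist_cylSet_le_iff]
        refine ⟨hzw.1.trans (by linarith), ?_⟩
        simp only [hcoe w hw]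
        push_cast
        grind
    refine ⟨S + T, by positivity, fun z w hzw => ?_⟩
    by_cases hz : z.1.2 ≤ p z.1.1 + 1 <;> by_cases hw : w.1.2 ≤ p w.1.1 + 1
    · rw [hLH z hz, hLH w hw]
      refine (hHS _ _ ?_).trans (by linarith)
      rw [dist_cylSet_le_iff] at hzw ⊢
      exact ⟨hzw.1.trans (by linarith), hzw.2.trans (by linarith)⟩
    · exact mixed z w hzw hz hw
    · rw [dist_comm]
      exact mixed w z (by rwa [dist_comm]) hw hz
    · rw [hLK z hz, hLK w hw]
      refine (hKT _ _ ?_).trans (by linarith)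
      rw [dist_cylSet_le_iff] at hzw ⊢
      have h1 := hpP _ _ hzw.1
      rw [NNReal.dist_eq] at h1
      refine ⟨hzw.1.trans (by linarith), ?_⟩
      simp only [hcoe w hw, hcoe z hz]
      grind
  · intro B hB
    let a : cylSet p → cylSet fun x => p x + q x + 1 := fun z =>
      ⟨z.1, (show z.1.2 ≤ p z.1.1 + 1 from z.2).trans
        (show p z.1.1 + 1 ≤ p z.1.1 + q z.1.1 + 1 + 1 by
          gcongr; rw [add_assoc]; exact le_self_add)⟩
    let b : cylSet q → cylSet fun x => p x + q x + 1 := fun z =>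
      ⟨(z.1.1, z.1.2 + (p z.1.1 + 1)), by
        have : z.1.2 ≤ q z.1.1 + 1 := z.2
        simp only [cylSet, Set.mem_ofPred_eq]
        calc _ ≤ (q z.1.1 + 1) + (p z.1.1 + 1) := by gcongr
          _ = _ := by ring⟩
    have ha : Controlled a := fun R hR => ⟨R, hR, fun _ _ h => h⟩
    have hb : Controlled b := by
      intro R hR
      obtain ⟨P, hP, hpP⟩ := hp.1 R hR
      refine ⟨R + P, by positivity, fun z w hzw => ?_⟩
      rw [dist_cylSet_le_iff] at hzw ⊢
      have h1 := hpP _ _ hzw.1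
      rw [NNReal.dist_eq] at h1
      refine ⟨hzw.1.trans (by linarith), ?_⟩
      simp only [b]
      push_cast
      grind
    refine ((ha.isBounded_image (hH.2 B hB)).union (hb.isBounded_image (hK.2 B hB))).subset ?_
    intro z hz
    by_cases hz' : z.1.2 ≤ p z.1.1 + 1
    · left
      rw [Set.mem_preimage, hLH z hz'] at hz
      exact ⟨_, hz, rfl⟩
    · right
      rw [Set.mem_preimage, hLK z hz'] at hz
      refine ⟨_, hz, Subtype.ext (Prod.ext rfl ?_)⟩
      exact tsub_add_cancel_of_le (not_le.1 hz').le
  · intro x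
    rw [hLH _ (by simp)]
    exact hH0 x
  · intro x
    have hlt : ¬ p x + q x + 1 + 1 ≤ p x + 1 := by
      rw [not_le, ← NNReal.coe_lt_coe]
      push_cast
      linarith [(q x).2, NNReal.coe_nonneg (q x)]
    rw [hLK _ hlt, ← hK1 x]
    congr 3
    simp only
    rw [show p x + q x + 1 + 1 = (q x + 1) + (p x + 1) by ring, add_tsub_cancel_right]

theorem isCoarseMap_id {X : Type*} [PseudoMetricSpace X] : IsCoarseMap (id : X → X) :=
  ⟨fun R hR => ⟨R, hR, fun _ _ h => h⟩, fun _ hB => hB⟩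

/-- A criterion for maps out of the half line to be coarsely homotopic, through a cylinder of
height `x + 1`; the homotopy `H` only has to match the two maps up to bounded distance. -/
theorem coarseHomotopic_of_isClose {E : Type*} [NormedAddCommGroup E] (H : ℝ → ℝ → E)
    (f g : ℝ≥0 → E) (C : ℝ)
    (hc : ∀ R : ℝ, 0 < R → ∃ S : ℝ, ∀ x y s t : ℝ, 0 ≤ x → 0 ≤ y → 0 ≤ s → 0 ≤ t →
      s ≤ x + 1 → t ≤ y + 1 → |x - y| ≤ R → |s - t| ≤ R → ‖H x s - H y t‖ ≤ S)
    (hp : ∀ R : ℝ, ∃ M : ℝ, ∀ x t : ℝ, 0 ≤ x → 0 ≤ t → t ≤ x + 1 → ‖H x t‖ ≤ R → x ≤ M)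
    (hf : ∀ x : ℝ≥0, ‖f x - H x 0‖ ≤ C) (hg : ∀ x : ℝ≥0, ‖g x - H x (x + 1)‖ ≤ C) :
    CoarseHomotopic f g := by
  have hC : 0 ≤ C := (norm_nonneg _).trans (hf 0)
  have hcyl (z : cylSet (id : ℝ≥0 → ℝ≥0)) : (z.1.2 : ℝ) ≤ z.1.1 + 1 := mod_cast z.2
  let G : cylSet (id : ℝ≥0 → ℝ≥0) → E := fun z =>
    if z.1.2 = 0 then f z.1.1 else if z.1.2 = z.1.1 + 1 then g z.1.1 else H z.1.1 z.1.2
  have hG (z) : ‖G z - H z.1.1 z.1.2‖ ≤ C := by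
    by_cases h0 : z.1.2 = 0
    · simpa [G, h0] using hf z.1.1
    by_cases h1 : z.1.2 = z.1.1 + 1
    · simpa [G, h1] using hg z.1.1
    · simpa [G, h0, h1] using hC
  refine ⟨id, isCoarseMap_id, G, ⟨?_, ?_⟩, ?_, ?_⟩
  · intro R hR
    obtain ⟨S, hS⟩ := hc R hR
    refine ⟨max S 0 + 2 * C + 1, by positivity, fun z w hzw => ?_⟩
    rw [dist_cylSet_le_iff, NNReal.dist_eq] at hzw
    have h := hS z.1.1 w.1.1 z.1.2 w.1.2 z.1.1.2 w.1.1.2 z.1.2.2 w.1.2.2 (hcyl z) (hcyl w)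
      hzw.1 hzw.2
    have hz := hG z
    have hw := hG w
    rw [← dist_eq_norm] at h hz hw
    have := dist_triangle4_right (G z) (G w) (H z.1.1 z.1.2) (H w.1.1 w.1.2)
    linarith [le_max_left S 0]
  · intro B hB
    obtain ⟨r, hr⟩ := hB.exists_norm_le
    obtain ⟨M, hM⟩ := hp (r + C)
    refine Metric.isBounded_iff.2 ⟨M + 1, fun z hz w hw => ?_⟩
    have key (z) (hz : z ∈ G ⁻¹' B) : (z.1.1 : ℝ) ≤ M := by
      refine hM _ z.1.2 z.1.1.2 z.1.2.2 (hcyl z) ?_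
      have h1 := hr _ hz
      have h2 := hG z
      have h3 := norm_sub_norm_le (H z.1.1 z.1.2) (G z)
      rw [norm_sub_rev] at h3
      linarith
    rw [dist_cylSet_le_iff, NNReal.dist_eq, abs_le, abs_le]
    have h1 := key z hz
    have h2 := key w hw
    have h3 := hcyl z
    have h4 := hcyl w
    have h5 := z.1.1.2
    have h6 := w.1.1.2
    have h7 := z.1.2.2
    have h8 := w.1.2.2
    simp only [NNReal.val_eq_coe] at h5 h6 h7 h8
    refine ⟨⟨?_, ?_⟩, ⟨?_, ?_⟩⟩ <;> linarith
  · intro x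
    simp [G]
  · intro x
    simp [G]

theorem abs_sqrt_sub_sqrt_mul_le {x y : ℝ} (hx : 0 ≤ x) (hy : 0 ≤ y) :
    √(y + 1) * |√(x + 1) - √(y + 1)| ≤ |x - y| := by
  have h : x - y = (√(x + 1) + √(y + 1)) * (√(x + 1) - √(y + 1)) := by
    have h1 := Real.sq_sqrt (show 0 ≤ x + 1 by positivity)
    have h2 := Real.sq_sqrt (show 0 ≤ y + 1 by positivity)
    linear_combination h2 - h1
  rw [h, abs_mul, abs_of_nonneg (show 0 ≤ √(x + 1) + √(y + 1) by positivity)]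
  exact mul_le_mul_of_nonneg_right (le_add_of_nonneg_left (Real.sqrt_nonneg _)) (abs_nonneg _)

theorem one_le_sqrt_add_one {x : ℝ} (hx : 0 ≤ x) : 1 ≤ √(x + 1) :=
  Real.one_le_sqrt.2 (by linarith)

theorem abs_sqrt_sub_sqrt_le {x y : ℝ} (hx : 0 ≤ x) (hy : 0 ≤ y) :
    |√(x + 1) - √(y + 1)| ≤ |x - y| :=
  (le_mul_of_one_le_left (abs_nonneg _) (one_le_sqrt_add_one hy)).trans
    (abs_sqrt_sub_sqrt_mul_le hx hy)

theorem sqrt_mul_abs_div_sqrt_sub_le {x y m k : ℝ} (hx : 0 ≤ x) (hy : 0 ≤ y) (hk : 0 ≤ k)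
    (hky : k ≤ y + 1) :
    √(x + 1) * |m / √(x + 1) - k / √(y + 1)| ≤ |m - k| + |x - y| := by
  have ha := one_le_sqrt_add_one hx
  have hb := one_le_sqrt_add_one hy
  have h := abs_sqrt_sub_sqrt_mul_le hx hy
  have hb2 := Real.sq_sqrt (show 0 ≤ y + 1 by positivity)
  set a := √(x + 1)
  set b := √(y + 1)
  have ha0 : 0 < a := by linarith
  have hb0 : 0 < b := by linarith
  calc a * |m / a - k / b| = |(m - k) + k / b * (b - a)| := by
        rw [← abs_of_pos ha0, ← abs_mul, abs_of_pos ha0]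
        congr 1
        field_simp
        ring
    _ ≤ |m - k| + |k / b * (b - a)| := abs_add_le _ _
    _ ≤ |m - k| + b * |a - b| := by
        rw [abs_mul, abs_of_nonneg (show 0 ≤ k / b by positivity), abs_sub_comm b a]
        gcongr
        rw [div_le_iff₀ hb0]
        linarith
    _ ≤ _ := by gcongr

theorem abs_div_sqrt_sub_le {x y m k : ℝ} (hx : 0 ≤ x) (hy : 0 ≤ y) (hk : 0 ≤ k)
    (hky : k ≤ y + 1) :
    |m / √(x + 1) - k / √(y + 1)| ≤ |m - k| + |x - y| :=
  (le_mul_of_one_le_left (abs_nonneg _) (one_le_sqrt_add_one hx)).trans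
    (sqrt_mul_abs_div_sqrt_sub_le hx hy hk hky)

theorem le_sq_of_sqrt_le {x R : ℝ} (h : √(x + 1) ≤ R) : x ≤ R ^ 2 := by
  have := (Real.sqrt_le_left (y := R) (x := x + 1) ((Real.sqrt_nonneg _).trans h)).1 h
  linarith

theorem le_sq_of_div_sqrt_le {x R : ℝ} (hx : 0 ≤ x) (h : x / √(x + 1) ≤ R) :
    x ≤ (R + 1) ^ 2 := by
  refine le_sq_of_sqrt_le ?_
  have ha := one_le_sqrt_add_one hx
  have h2 := Real.sq_sqrt (show 0 ≤ x + 1 by positivity)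
  rw [div_le_iff₀ (by linarith)] at h
  nlinarith

/-- The rays in two directions that are close to each other are coarsely homotopic. -/
theorem coarseHomotopic_sqrt_smul_of_norm_sub_le {E : Type*} [NormedAddCommGroup E]
    [NormedSpace ℝ E] {u v : E} (hu : u ≠ 0) (huv : ‖v - u‖ ≤ ‖u‖ / 2) :
    CoarseHomotopic (fun x : ℝ≥0 => √((x : ℝ) + 1) • u) (fun x : ℝ≥0 => √((x : ℝ) + 1) • v) := by
  have hu0 : 0 < ‖u‖ := norm_pos_iff.2 hu
  refine coarseHomotopic_of_isClose
    (fun x t => √(x + 1) • (u + min (t / √(x + 1)) 1 • (v - u))) _ _ 0 ?_ ?_ ?_ ?_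
  · intro R hR
    refine ⟨R * (‖u‖ + ‖v - u‖) + (R + R) * ‖v - u‖, fun x y s t hx hy hs ht hsx hty hxy hst => ?_⟩
    have h1 := sqrt_mul_abs_div_sqrt_sub_le (m := s) hx hy ht hty
    have h2 := abs_sqrt_sub_sqrt_le hx hy
    have h3 : |min (s / √(x + 1)) 1 - min (t / √(y + 1)) 1| ≤ |s / √(x + 1) - t / √(y + 1)| := by
      simpa using abs_min_sub_min_le_max (s / √(x + 1)) 1 (t / √(y + 1)) 1
    have h4 : |min (t / √(y + 1)) 1| ≤ 1 := by
      rw [abs_of_nonneg (by positivity)]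
      exact min_le_right _ _
    set a := √(x + 1)
    set b := √(y + 1)
    set c := min (s / a) 1
    set d := min (t / b) 1
    have hab : a • (u + c • (v - u)) - b • (u + d • (v - u)) =
        (a - b) • (u + d • (v - u)) + (a * (c - d)) • (v - u) := by module
    rw [hab]
    refine (norm_add_le _ _).trans ?_
    rw [norm_smul, norm_smul, Real.norm_eq_abs, Real.norm_eq_abs, abs_mul,
      abs_of_nonneg (show 0 ≤ a from Real.sqrt_nonneg _)]
    gcongr
    · exact h2.trans hxy
    · refine (norm_add_le _ _).trans ?_
      rw [norm_smul, Real.norm_eq_abs]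
      gcongr
      exact mul_le_of_le_one_left (norm_nonneg _) h4
    · calc a * |c - d| ≤ a * |s / a - t / b| := by gcongr
        _ ≤ _ := h1
        _ ≤ _ := by gcongr
  · intro R
    refine ⟨(R / (‖u‖ / 2)) ^ 2, fun x t hx ht htx h => le_sq_of_sqrt_le ?_⟩
    rw [le_div_iff₀ (by positivity)]
    refine le_trans ?_ h
    rw [norm_smul, Real.norm_eq_abs, abs_of_nonneg (Real.sqrt_nonneg _)]
    gcongr
    set c := min (t / √(x + 1)) 1
    have hc : ‖c • (v - u)‖ ≤ ‖u‖ / 2 := by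
      rw [norm_smul, Real.norm_eq_abs, abs_of_nonneg (by positivity)]
      exact (mul_le_of_le_one_left (norm_nonneg _) (min_le_right _ _)).trans huv
    have := norm_sub_le (u + c • (v - u)) (c • (v - u))
    rw [add_sub_cancel_right] at this
    linarith
  · intro x
    simp
  · intro x
    have h : 1 ≤ ((x : ℝ) + 1) / √((x : ℝ) + 1) := by
      rw [Real.div_sqrt]
      exact one_le_sqrt_add_one x.2
    simp only [min_eq_right h]
    simp

theorem coarseHomotopic_sqrt_smul {E : Type*} [NormedAddCommGroup E] [NormedSpace ℝ E]
    (hE : 1 < Module.rank ℝ E) {u v : E} (hu : u ≠ 0) (hv : v ≠ 0) :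
    CoarseHomotopic (fun x : ℝ≥0 => √((x : ℝ) + 1) • u) (fun x : ℝ≥0 => √((x : ℝ) + 1) • v) := by
  refine (isConnected_compl_singleton_of_one_lt_rank hE (0 : E)).isPreconnected.induction₂
    (fun u v : E => CoarseHomotopic (fun x : ℝ≥0 => √((x : ℝ) + 1) • u)
      (fun x : ℝ≥0 => √((x : ℝ) + 1) • v)) ?_ (fun _ _ _ _ _ _ h h' => h.trans h')
    (fun _ _ _ _ h => h.symm) hu hv
  intro w hw
  have hw0 : 0 < ‖w‖ := norm_pos_iff.2 hw
  filter_upwards [mem_nhdsWithin_of_mem_nhds (Metric.closedBall_mem_nhds w (half_pos hw0))]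
    with z hz
  exact coarseHomotopic_sqrt_smul_of_norm_sub_le hw (by rwa [← dist_eq_norm])

/-- The point `F a` pushed radially outwards by the distance `b`. -/
noncomputable def radialPush {E : Type*} [NormedAddCommGroup E] [NormedSpace ℝ E] (F : ℝ → E)
    (a b : ℝ) : E :=
  F a + b • ‖F a‖⁻¹ • F a

theorem norm_radialPush {E : Type*} [NormedAddCommGroup E] [NormedSpace ℝ E] {F : ℝ → E}
    {a b : ℝ} (ha : F a ≠ 0) (hb : 0 ≤ b) : ‖radialPush F a b‖ = ‖F a‖ + b := by
  have h : 0 < ‖F a‖ := norm_pos_iff.2 ha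
  have : radialPush F a b = (1 + b * ‖F a‖⁻¹) • F a := by
    rw [radialPush]; module
  rw [this, norm_smul, Real.norm_eq_abs, abs_of_nonneg (by positivity)]
  field_simp

theorem norm_inv_norm_smul_sub_le {E : Type*} [NormedAddCommGroup E] [NormedSpace ℝ E] {u v : E}
    (hu : 1 ≤ ‖u‖) (hv : 1 ≤ ‖v‖) : ‖‖u‖⁻¹ • u - ‖v‖⁻¹ • v‖ ≤ 2 * ‖u - v‖ := by
  have hu0 : 0 < ‖u‖ := by linarith
  have hv0 : 0 < ‖v‖ := by linarith
  have h : ‖u‖⁻¹ • u - ‖v‖⁻¹ • v = ‖u‖⁻¹ • (u - v) + (‖u‖⁻¹ - ‖v‖⁻¹) • v := by module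
  have hu1 : ‖u‖⁻¹ ≤ 1 := inv_le_one_of_one_le₀ hu
  rw [h, two_mul]
  refine (norm_add_le _ _).trans (add_le_add ?_ ?_)
  · rw [norm_smul, norm_inv, norm_norm]
    exact mul_le_of_le_one_left (norm_nonneg _) hu1
  · rw [norm_smul, Real.norm_eq_abs]
    calc |‖u‖⁻¹ - ‖v‖⁻¹| * ‖v‖ = ‖u‖⁻¹ * |‖u‖ - ‖v‖| := by
          rw [← abs_of_pos hv0, ← abs_mul, abs_of_pos hv0, ← abs_of_pos (inv_pos.2 hu0),
            ← abs_mul, abs_of_pos (inv_pos.2 hu0), ← abs_neg]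
          congr 1
          field_simp
          ring
      _ ≤ 1 * ‖u - v‖ := by
          gcongr
          exact abs_norm_sub_norm_le u v
      _ = _ := one_mul _

theorem norm_radialPush_sub_le {E : Type*} [NormedAddCommGroup E] [NormedSpace ℝ E] {F : ℝ → E}
    {K : ℝ≥0} (hF : LipschitzWith K F) (h1 : ∀ a, 1 ≤ ‖F a‖) {a b a' b' : ℝ} (hb : 0 ≤ b) :
    ‖radialPush F a b - radialPush F a' b'‖ ≤
      K * |a - a'| + 2 * K * (b * |a - a'|) + |b - b'| := by
  have hFa : ‖F a - F a'‖ ≤ K * |a - a'| := by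
    simpa [dist_eq_norm] using hF.dist_le_mul a a'
  have h : radialPush F a b - radialPush F a' b' = (F a - F a') +
      b • (‖F a‖⁻¹ • F a - ‖F a'‖⁻¹ • F a') + (b - b') • ‖F a'‖⁻¹ • F a' := by
    simp only [radialPush]; module
  rw [h]
  refine norm_add₃_le.trans ?_
  gcongr
  · rw [norm_smul, Real.norm_eq_abs, abs_of_nonneg hb]
    calc b * _ ≤ b * (2 * (K * |a - a'|)) := by
          gcongr
          exact (norm_inv_norm_smul_sub_le (h1 a) (h1 a')).trans (by gcongr)
      _ = _ := by ring
  · have h0 : ‖F a'‖ ≠ 0 := by linarith [h1 a']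
    rw [norm_smul, norm_smul, norm_inv, norm_norm, inv_mul_cancel₀ h0, mul_one, Real.norm_eq_abs]

theorem coarseHomotopic_of_radialPush {E : Type*} [NormedAddCommGroup E] [NormedSpace ℝ E]
    {F : ℝ → E} {K : ℝ≥0} (hF : LipschitzWith K F) (h1 : ∀ a, 1 ≤ ‖F a‖)
    (hF' : ∀ R : ℝ, ∃ M : ℝ, ∀ a, ‖F a‖ ≤ R → a ≤ M) (a b : ℝ → ℝ → ℝ)
    (f g : ℝ≥0 → E) (C : ℝ)
    (hb : ∀ x t : ℝ, 0 ≤ x → 0 ≤ t → 0 ≤ b x t)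
    (hab : ∀ x y s t R : ℝ, 0 ≤ x → 0 ≤ y → 0 ≤ s → 0 ≤ t → |x - y| ≤ R → |s - t| ≤ R →
      |a x s - a y t| ≤ 3 * R ∧ b x s * |a x s - a y t| ≤ 3 * R ∧ |b x s - b y t| ≤ R)
    (hp : ∀ x t R : ℝ, 0 ≤ x → 0 ≤ t → t ≤ x + 1 → a x t ≤ R → b x t ≤ R → x ≤ (R + 1) ^ 2)
    (hf : ∀ x : ℝ≥0, ‖f x - radialPush F (a x 0) (b x 0)‖ ≤ C)
    (hg : ∀ x : ℝ≥0, ‖g x - radialPush F (a x (x + 1)) (b x (x + 1))‖ ≤ C) :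
    CoarseHomotopic f g := by
  refine coarseHomotopic_of_isClose (fun x t => radialPush F (a x t) (b x t)) f g C ?_ ?_ hf hg
  · intro R hR
    refine ⟨K * (3 * R) + 2 * K * (3 * R) + R, fun x y s t hx hy hs ht _ _ hxy hst => ?_⟩
    obtain ⟨h2, h3, h4⟩ := hab x y s t R hx hy hs ht hxy hst
    refine (norm_radialPush_sub_le hF h1 (hb x s hx hs)).trans ?_
    gcongr
  · intro R
    obtain ⟨M, hM⟩ := hF' R
    refine ⟨(max M R + 1) ^ 2, fun x t hx ht htx h => ?_⟩
    have hFa := h1 (a x t)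
    rw [norm_radialPush (norm_pos_iff.1 (by linarith)) (hb x t hx ht)] at h
    have hbx := hb x t hx ht
    exact hp x t _ hx ht htx ((hM _ (by linarith)).trans (le_max_left _ _))
      (le_max_of_le_right (by linarith))

theorem coarseHomotopic_sqrt_smul_of_lipschitzWith {E : Type*} [NormedAddCommGroup E]
    [NormedSpace ℝ E] {F : ℝ → E} {K : ℝ≥0} (hF : LipschitzWith K F) (h1 : ∀ a, 1 ≤ ‖F a‖)
    (hF' : ∀ R : ℝ, ∃ M : ℝ, ∀ a, ‖F a‖ ≤ R → a ≤ M) {f : ℝ≥0 → E} {C : ℝ}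
    (hf : ∀ x : ℝ≥0, ‖f x - F x‖ ≤ C) :
    CoarseHomotopic f (fun x : ℝ≥0 => √((x : ℝ) + 1) • ‖F 0‖⁻¹ • F 0) := by
  have hdiv {x : ℝ} (hx : 0 ≤ x) : x / √(x + 1) ≤ x :=
    div_le_self hx (one_le_sqrt_add_one hx)
  have hs {x y R : ℝ} (hx : 0 ≤ x) (hy : 0 ≤ y) (hxy : |x - y| ≤ R) :
      |x / √(x + 1) - y / √(y + 1)| ≤ 3 * R := by
    have := abs_div_sqrt_sub_le (m := x) hx hy hy (by linarith)
    linarith [abs_nonneg (x - y)]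
  have hm {x y s t R : ℝ} (hxy : |x - y| ≤ R) (hst : |s - t| ≤ R) :
      |max (x - s) 0 - max (y - t) 0| ≤ 2 * R := by
    refine (abs_max_sub_max_le_abs _ _ _).trans ?_
    rw [show x - s - (y - t) = (x - y) - (s - t) by ring]
    exact (abs_sub _ _).trans (by linarith)
  have hC : 0 ≤ C := (norm_nonneg _).trans (hf 0)
  have slow : CoarseHomotopic f
      (fun x : ℝ≥0 => radialPush F ((x : ℝ) / √((x : ℝ) + 1)) 0) := by
    refine coarseHomotopic_of_radialPush hF h1 hF' (fun x t => max (x - t) (x / √(x + 1)))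
      (fun _ _ => 0) _ _ C (fun _ _ _ _ => le_rfl) ?_ ?_ ?_ ?_
    · intro x y s t R hx hy hs' ht hxy hst
      have hR : 0 ≤ R := (abs_nonneg _).trans hxy
      refine ⟨(abs_max_sub_max_le_max _ _ _ _).trans (max_le ?_ (hs hx hy hxy)), ?_, ?_⟩
      · rw [show x - s - (y - t) = (x - y) - (s - t) by ring]
        exact (abs_sub _ _).trans (by linarith)
      · simpa using hR
      · simpa using hR
    · intro x t R hx ht htx ha hb
      exact le_sq_of_div_sqrt_le hx ((le_max_right _ _).trans ha)
    · intro x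
      have : max ((x : ℝ) - 0) (x / √((x : ℝ) + 1)) = x := by
        rw [sub_zero]
        exact max_eq_left (hdiv x.2)
      simpa only [this, radialPush, zero_smul, add_zero] using hf x
    · intro x
      have : (x : ℝ) - (x + 1) ≤ x / √((x : ℝ) + 1) := by
        have : 0 ≤ (x : ℝ) / √((x : ℝ) + 1) := by positivity
        linarith
      simpa only [max_eq_right this, sub_self, norm_zero] using hC
  have push : CoarseHomotopic (fun x : ℝ≥0 => radialPush F ((x : ℝ) / √((x : ℝ) + 1)) 0)
      (fun x : ℝ≥0 => radialPush F ((x : ℝ) / √((x : ℝ) + 1)) √((x : ℝ) + 1)) := by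
    refine coarseHomotopic_of_radialPush hF h1 hF' (fun x _ => x / √(x + 1))
      (fun x t => min t √(x + 1)) _ _ 0 (fun _ _ _ ht => by positivity) ?_ ?_ ?_ ?_
    · intro x y s t R hx hy hs' ht hxy hst
      refine ⟨hs hx hy hxy, ?_, ?_⟩
      · have := sqrt_mul_abs_div_sqrt_sub_le (m := x) hx hy hy (by linarith)
        refine (mul_le_mul_of_nonneg_right (min_le_right _ _) (abs_nonneg _)).trans ?_
        linarith [abs_nonneg (x - y)]
      · exact (abs_min_sub_min_le_max _ _ _ _).trans
          (max_le hst ((abs_sqrt_sub_sqrt_le hx hy).trans hxy))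
    · intro x t R hx ht htx ha hb
      exact le_sq_of_div_sqrt_le hx ha
    · intro x
      simp [Real.sqrt_nonneg]
    · intro x
      have : √((x : ℝ) + 1) ≤ x + 1 := Real.sqrt_le_self_iff.2 (by simp)
      simp [this]
  have rewind : CoarseHomotopic
      (fun x : ℝ≥0 => radialPush F ((x : ℝ) / √((x : ℝ) + 1)) √((x : ℝ) + 1))
      (fun x : ℝ≥0 => √((x : ℝ) + 1) • ‖F 0‖⁻¹ • F 0) := by
    refine coarseHomotopic_of_radialPush hF h1 hF' (fun x t => max (x - t) 0 / √(x + 1))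
      (fun x _ => √(x + 1)) _ _ ‖F 0‖ (fun _ _ _ _ => by positivity) ?_ ?_ ?_ ?_
    · intro x y s t R hx hy hs' ht hxy hst
      have hmy : max (y - t) 0 ≤ y + 1 := max_le (by linarith) (by linarith)
      have hmR := hm hxy hst
      refine ⟨?_, ?_, (abs_sqrt_sub_sqrt_le hx hy).trans hxy⟩
      · linarith [abs_div_sqrt_sub_le (m := max (x - s) 0) hx hy (le_max_right (y - t) 0) hmy]
      · linarith [sqrt_mul_abs_div_sqrt_sub_le (m := max (x - s) 0) hx hy
          (le_max_right (y - t) 0) hmy]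
    · intro x t R hx ht htx ha hb
      exact le_sq_of_sqrt_le (hb.trans (by linarith))
    · intro x
      simp
    · intro x
      simp [radialPush]
  exact (slow.trans push).trans rewind

/-- A controlled map on the half line is at bounded distance from a Lipschitz map on the line. -/
theorem Controlled.exists_lipschitzWith {E : Type*} [NormedAddCommGroup E] [NormedSpace ℝ E]
    [FiniteDimensional ℝ E] {f : ℝ≥0 → E} (hf : Controlled f) :
    ∃ (G : ℝ → E) (K : ℝ≥0) (C : ℝ), LipschitzWith K G ∧ ∀ x : ℝ≥0, ‖f x - G x‖ ≤ C := by
  obtain ⟨S, hS, hfS⟩ := hf 1 one_pos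
  have hnat (m n : ℕ) (hmn : m ≤ n) : dist (f m) (f n) ≤ S * |(m : ℝ) - n| := by
    refine (dist_le_Ico_sum_of_dist_le (f := fun k : ℕ => f k) (d := fun _ => S) hmn
      fun _ _ => hfS _ _ (by simp [NNReal.dist_eq])).trans ?_
    rw [abs_sub_comm, abs_of_nonneg (sub_nonneg.2 (mod_cast hmn))]
    simp [Nat.cast_sub hmn, mul_comm]
  have hlip : LipschitzOnWith S.toNNReal (fun x : ℝ => f x.toNNReal)
      (Set.range ((↑) : ℕ → ℝ)) := by
    refine LipschitzOnWith.of_dist_le_mul ?_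
    rintro _ ⟨m, rfl⟩ _ ⟨n, rfl⟩
    simp only [Real.toNNReal_natCast, Real.dist_eq, Real.coe_toNNReal S hS.le]
    rcases le_total m n with h | h
    · exact hnat m n h
    · rw [dist_comm, abs_sub_comm]
      exact hnat n m h
  obtain ⟨G, hG, hfG⟩ := hlip.extend_finite_dimension
  refine ⟨G, _, S + (lipschitzExtensionConstant E * S.toNNReal : ℝ≥0) * 1, hG, fun x => ?_⟩
  have hx : dist (x : ℝ) (⌊x⌋₊ : ℝ) ≤ 1 := by
    have h1 : ((⌊x⌋₊ : ℝ≥0) : ℝ) ≤ x := NNReal.coe_le_coe.2 (Nat.floor_le x.2)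
    have h2 : (x : ℝ) < ((⌊x⌋₊ + 1 : ℝ≥0) : ℝ) := NNReal.coe_lt_coe.2 (Nat.lt_floor_add_one x)
    push_cast at h1 h2
    rw [Real.dist_eq, abs_le]
    constructor <;> linarith
  have hfl : f (⌊x⌋₊ : ℝ≥0) = G (⌊x⌋₊ : ℝ) := by
    simpa using hfG ⟨⌊x⌋₊, rfl⟩
  rw [← dist_eq_norm]
  refine (dist_triangle _ (f (⌊x⌋₊ : ℝ≥0)) _).trans (add_le_add (hfS _ _ ?_) ?_)
  · simpa [NNReal.dist_eq, Real.dist_eq] using hx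
  · rw [hfl, dist_comm]
    exact (hG.dist_le_mul _ _).trans (by gcongr)

theorem IsCoarseMap.exists_lipschitzWith {E : Type*} [NormedAddCommGroup E] [NormedSpace ℝ E]
    [FiniteDimensional ℝ E] {f : ℝ≥0 → E} (hf : IsCoarseMap f) :
    ∃ (F : ℝ → E) (K : ℝ≥0) (C : ℝ), LipschitzWith K F ∧ (∀ a, 1 ≤ ‖F a‖) ∧
      (∀ R : ℝ, ∃ M : ℝ, ∀ a, ‖F a‖ ≤ R → a ≤ M) ∧ ∀ x : ℝ≥0, ‖f x - F x‖ ≤ C := by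
  obtain ⟨G, K, C, hG, hfG⟩ := hf.1.exists_lipschitzWith
  have hproper (R : ℝ) : ∃ M : ℝ, 0 ≤ M ∧ ∀ a, ‖G a‖ ≤ R → a ≤ M := by
    obtain ⟨M, hM⟩ := 
      (hf.2 _ (Metric.isBounded_closedBall (x := 0) (r := R + C))).subset_closedBall 0
    refine ⟨max M 0, le_max_right _ _, fun a ha => ?_⟩
    rcases le_total a 0 with h | h
    · exact le_max_of_le_right h
    lift a to ℝ≥0 using h
    have hfa : a ∈ f ⁻¹' Metric.closedBall 0 (R + C) := by
      simp only [Set.mem_preimage, mem_closedBall_zero_iff]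
      have := norm_sub_norm_le (f a) (G a)
      linarith [hfG a]
    have := hM hfa
    rw [Metric.mem_closedBall, NNReal.dist_eq] at this
    simp at this
    exact le_max_of_le_left this
  obtain ⟨M, hM0, hM⟩ := hproper 1
  refine ⟨fun a => G (max a (M + 1)), K, C + K * (M + 1), ?_, fun a => ?_, fun R => ?_, fun x => ?_⟩
  · simpa [Function.comp_def] using hG.comp (LipschitzWith.id.max_const (M + 1))
  · by_contra! h
    linarith [hM _ h.le, le_max_right a (M + 1)]
  · obtain ⟨N, -, hN⟩ := hproper R
    exact ⟨N, fun a ha => (le_max_left _ _).trans (hN _ ha)⟩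
  · have h : dist (G x) (G (max x (M + 1))) ≤ K * (M + 1) := by
      refine (hG.dist_le_mul _ _).trans ?_
      gcongr
      rw [Real.dist_eq, abs_sub_comm, abs_of_nonneg (sub_nonneg.2 (le_max_left _ _)),
        sub_le_iff_le_add]
      have := x.2
      simp only [NNReal.val_eq_coe] at this
      exact max_le (by linarith) (by linarith)
    have := dist_triangle (f x) (G x) (G (max x (M + 1)))
    rw [dist_eq_norm (f x), dist_eq_norm (f x)] at this
    linarith [hfG x]

/-- For `n ≥ 2`, any two coarse maps `ℝ₊ → ℝⁿ` are coarsely homotopic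
(`π₀^coarse(ℝⁿ)` is a single point). -/
theorem coarse_maps_to_euclidean_coarsely_homotopic (n : ℕ) (hn : 2 ≤ n)
    (f g : ℝ≥0 → EuclideanSpace ℝ (Fin n))
    (hf : IsCoarseMap f) (hg : IsCoarseMap g) :
    CoarseHomotopic f g := by
  have hrank : 1 < Module.rank ℝ (EuclideanSpace ℝ (Fin n)) := by
    rw [← Module.finrank_eq_rank, finrank_euclideanSpace_fin]
    exact_mod_cast hn
  obtain ⟨F, _, _, hF, hF1, hFp, hfF⟩ := hf.exists_lipschitzWith
  obtain ⟨G, _, _, hG, hG1, hGp, hgG⟩ := hg.exists_lipschitzWith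
  have hne {v : EuclideanSpace ℝ (Fin n)} (hv : 1 ≤ ‖v‖) : ‖v‖⁻¹ • v ≠ 0 := by
    have h : v ≠ 0 := norm_pos_iff.1 (by linarith)
    simpa using h
  exact ((coarseHomotopic_sqrt_smul_of_lipschitzWith hF hF1 hFp hfF).trans
    (coarseHomotopic_sqrt_smul hrank (hne (hF1 0)) (hne (hG1 0)))).trans
    (coarseHomotopic_sqrt_smul_of_lipschitzWith hG hG1 hGp hgG).symm
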